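/- For every integer δ ≥ 1 there exists an integer M such that for every integer m ≥ M, setting e = m − δ, the following holds: every numerical monoid Γ with embedding dimension e+1 and multiplicity m satisfies ρ(Γ) ≤ 𝒞(e,m), and there exists a numerical monoid Γ with embedding dimension e+1, multiplicity m, and ρ(Γ) = 𝒞(e,m). (That is, for each fixed value of m−e, the maximum 𝒭(e,m) of ρ(Γ) over all numerical monoids with embedding dimension e+1 and multiplicity m equals 𝒞(e,m) for all m ≫ 0.) -/

import Mathlib

open scoped Pointwise

/-- A numerical monoid: an additive submonoid of ℕ with finite complement. -/
def IsNumericalMonoid (Γ : AddSubmonoid ℕ) : Prop :=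
  ((Γ : Set ℕ)ᶜ).Finite

/-- The (unique) minimal generating set of a submonoid of ℕ: the nonzero elements
that are not sums of two nonzero elements. -/
def minGens (Γ : AddSubmonoid ℕ) : Set ℕ :=
  {g | g ∈ Γ ∧ g ≠ 0 ∧ ∀ a ∈ Γ, ∀ b ∈ Γ, a ≠ 0 → b ≠ 0 → g ≠ a + b}

/-- Embedding dimension: the number of minimal generators. -/
noncomputable def edim (Γ : AddSubmonoid ℕ) : ℕ :=
  (minGens Γ).ncard

/-- Multiplicity: the smallest nonzero element. -/
noncomputable def mult (Γ : AddSubmonoid ℕ) : ℕ :=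
  sInf {g : ℕ | g ∈ Γ ∧ g ≠ 0}

/-- The factorization homomorphism φ, sending a formal ℕ-combination of the minimal
generators to its value in ℕ. -/
noncomputable def factorizationHom (Γ : AddSubmonoid ℕ) : (minGens Γ →₀ ℕ) →+ ℕ :=
  Finsupp.liftAddHom fun g => AddMonoidHom.mulLeft (g : ℕ)

/-- The number of minimal relations ρ(Γ): the least cardinality of a set of pairs
generating the kernel congruence of the factorization homomorphism. -/
noncomputable def rho (Γ : AddSubmonoid ℕ) : ℕ :=
  sInf {n : ℕ | ∃ R : Set ((minGens Γ →₀ ℕ) × (minGens Γ →₀ ℕ)),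
    R.Finite ∧ R.ncard = n ∧
    addConGen (fun a b => (a, b) ∈ R) = AddCon.ker (factorizationHom Γ)}

/-- Pseudo-Frobenius numbers of Γ. -/
def pseudoFrobenius (Γ : AddSubmonoid ℕ) : Set ℕ :=
  {p | p ∉ Γ ∧ ∀ g ∈ Γ, g ≠ 0 → p + g ∈ Γ}

/-- The type of Γ: the number of pseudo-Frobenius numbers. -/
noncomputable def numType (Γ : AddSubmonoid ℕ) : ℕ :=
  (pseudoFrobenius Γ).ncard

/-- The Apéry set of Γ with respect to its multiplicity. -/
def aperySet (Γ : AddSubmonoid ℕ) : Set ℕ :=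
  {g | g ∈ Γ ∧ ¬ ∃ γ ∈ Γ, g = γ + mult Γ}

/-- The Macaulay upper function: if `n = C(n_d,d) + ⋯ + C(n_j,j)` is the Macaulay
expansion of `n`, then `macUpper d n = C(n_d+1,d+1) + ⋯ + C(n_j+1,j+1)`, i.e. `n^⟨d⟩`. -/
noncomputable def macUpper : ℕ → ℕ → ℕ
  | 0, _ => 0
  | d + 1, n =>
    if n = 0 then 0
    else
      Nat.choose (sSup {a : ℕ | Nat.choose a (d + 1) ≤ n} + 1) (d + 2) +
        macUpper d (n - Nat.choose (sSup {a : ℕ | Nat.choose a (d + 1) ≤ n}) (d + 1))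

/-- The Macaulay lower function: if `n = C(n_d,d) + ⋯ + C(n_j,j)` is the Macaulay
expansion of `n`, then `macLower d n = C(n_d-1,d) + ⋯ + C(n_j-1,j)`, i.e. `n_⟨d⟩`. -/
noncomputable def macLower : ℕ → ℕ → ℕ
  | 0, _ => 0
  | d + 1, n =>
    if n = 0 then 0
    else
      Nat.choose (sSup {a : ℕ | Nat.choose a (d + 1) ≤ n} - 1) (d + 1) +
        macLower d (n - Nat.choose (sSup {a : ℕ | Nat.choose a (d + 1) ≤ n}) (d + 1))

/-- The unique positive `r` with `C(e+r-1,r-1) ≤ m < C(e+r,r)`. -/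
noncomputable def macR (e m : ℕ) : ℕ :=
  sInf {r : ℕ | 0 < r ∧ m < Nat.choose (e + r) r}

/-- The bound 𝒞(e,m) = C(e+r-1,r) + s^⟨r⟩ - s, where s = m - C(e+r-1,r-1). -/
noncomputable def mathcalC (e m : ℕ) : ℕ :=
  Nat.choose (e + macR e m - 1) (macR e m) +
      macUpper (macR e m) (m - Nat.choose (e + macR e m - 1) (macR e m - 1)) -
    (m - Nat.choose (e + macR e m - 1) (macR e m - 1))

/-- The bound 𝒟(e,m) = C(e+r-2,r-1) + s_⟨r⟩, where s = m - C(e+r-1,r-1). -/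
noncomputable def mathcalD (e m : ℕ) : ℕ :=
  Nat.choose (e + macR e m - 2) (macR e m - 1) +
    macLower (macR e m) (m - Nat.choose (e + macR e m - 1) (macR e m - 1))

lemma two_mul_choose_two (n : ℕ) : 2 * (n + 1).choose 2 = n * (n + 1) := by
  rw [Nat.choose_two_right, Nat.mul_div_cancel' (Nat.even_mul_pred_self (n + 1)).two_dvd,
    Nat.add_sub_cancel, mul_comm]

lemma choose_two_succ (n : ℕ) : (n + 1).choose 2 = n.choose 2 + n := by
  rw [Nat.choose_succ_succ' n 1, Nat.choose_one_right, add_comm]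

lemma exists_eq_choose_two_add (n : ℕ) : ∃ j k : ℕ, n = (k + 1).choose 2 + j ∧ j ≤ k := by
  induction n with
  | zero => exact ⟨0, 0, by simp⟩
  | succ n ih =>
    obtain ⟨j, k, h, hjk⟩ := ih
    rcases hjk.lt_or_eq with hlt | rfl
    · exact ⟨j + 1, k, by omega, hlt⟩
    · exact ⟨0, j + 1, by rw [choose_two_succ (j + 1)]; omega, by omega⟩

lemma sSup_setOf_choose_le {d a n : ℕ} (h₁ : a.choose d ≤ n) (h₂ : n < (a + 1).choose d) :
    sSup {x : ℕ | x.choose d ≤ n} = a := by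
  have hg : IsGreatest {x : ℕ | x.choose d ≤ n} a := by
    refine ⟨h₁, fun x hx => ?_⟩
    by_contra! hlt
    exact absurd (h₂.trans_le (Nat.choose_le_choose d (Nat.succ_le_of_lt hlt))) hx.not_gt
  exact hg.csSup_eq

lemma macUpper_one (n : ℕ) : macUpper 1 n = (n + 1).choose 2 := by
  rcases Nat.eq_zero_or_pos n with rfl | hn
  · simp [macUpper]
  · have h : sSup {x : ℕ | x.choose 1 ≤ n} = n := sSup_setOf_choose_le (by simp) (by simp)
    simp only [macUpper, hn.ne', if_false, zero_add, h, add_zero]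

lemma macUpper_two_of_lt {k j : ℕ} (h : j ≤ k) :
    macUpper 2 ((k + 1).choose 2 + j) = (k + 2).choose 3 + (j + 1).choose 2 := by
  have hs : sSup {x : ℕ | x.choose (1 + 1) ≤ (k + 1).choose 2 + j} = k + 1 :=
    sSup_setOf_choose_le (by simp) (by rw [choose_two_succ (k + 1)]; omega)
  rcases Nat.eq_zero_or_pos ((k + 1).choose 2 + j) with h0 | h0
  · have hk : k = 0 := by
      by_contra hk
      have : 0 < (k + 1).choose 2 := Nat.choose_pos (by omega)
      omega
    subst hk
    have : j = 0 := by omega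
    subst this
    simp [macUpper]
  · rw [macUpper, if_neg h0.ne', hs, macUpper_one]
    congr 2
    rw [one_add_one_eq_two, Nat.add_sub_cancel_left]

lemma macUpper_two_of_le {k j : ℕ} (h : j ≤ k + 1) :
    macUpper 2 ((k + 1).choose 2 + j) = (k + 2).choose 3 + (j + 1).choose 2 := by
  rcases h.lt_or_eq with hlt | rfl
  · exact macUpper_two_of_lt (by omega)
  · rw [← choose_two_succ (k + 1), ← add_zero ((k + 1 + 1).choose 2), macUpper_two_of_lt (by omega),
      Nat.choose_succ_succ' (k + 2) 2, Nat.choose_eq_zero_of_lt (show 0 + 1 < 2 by norm_num),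
      add_zero, add_comm, add_zero]

lemma macUpper_two_zero : macUpper 2 0 = 0 := by simp [macUpper]

lemma macUpper_two_succ {k j : ℕ} (h : j ≤ k) :
    macUpper 2 ((k + 1).choose 2 + j + 1) = macUpper 2 ((k + 1).choose 2 + j) + (j + 1) := by
  rw [add_assoc, macUpper_two_of_le (by omega), macUpper_two_of_lt h, choose_two_succ (j + 1),
    add_assoc]

lemma macUpper_two_add_le (n d : ℕ) : macUpper 2 n + d ≤ macUpper 2 (n + d) := by
  induction d with
  | zero => simp
  | succ d ih =>
    obtain ⟨j, k, h, hjk⟩ := exists_eq_choose_two_add (n + d)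
    have := macUpper_two_succ hjk
    rw [← h] at this
    rw [← add_assoc n]
    omega

lemma macUpper_two_mono : Monotone (macUpper 2) := by
  refine monotone_nat_of_le_succ fun n => ?_
  have := macUpper_two_add_le n 1
  omega

lemma macUpper_two_add_choose_le {n d : ℕ} (h : (d + 1).choose 2 ≤ n + d) :
    macUpper 2 n + (d + 1).choose 2 ≤ macUpper 2 (n + d) := by
  obtain ⟨b, k, hs, hbk⟩ := exists_eq_choose_two_add (n + d)
  have hdk : d ≤ k := by
    by_contra! hlt
    have := Nat.choose_le_choose 2 (show k + 2 ≤ d + 1 by omega)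
    rw [choose_two_succ (k + 1)] at this
    omega
  rw [hs, macUpper_two_of_lt hbk]
  rcases le_or_gt d b with hdb | hdb
  · obtain ⟨c, rfl⟩ := Nat.exists_eq_add_of_le hdb
    have hn : n = (k + 1).choose 2 + c := by omega
    rw [hn, macUpper_two_of_lt (by omega)]
    have h1 := two_mul_choose_two c
    have h2 := two_mul_choose_two d
    have h3 := two_mul_choose_two (d + c)
    nlinarith
  · obtain ⟨t, rfl⟩ := Nat.exists_eq_add_of_le hdk
    obtain ⟨q, hq⟩ : ∃ q, d + t = q + 1 := ⟨d + t - 1, by omega⟩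
    have hn : n = (q + 1).choose 2 + (t + b) := by
      have := choose_two_succ (d + t)
      rw [hq] at this hs
      rw [this] at hs
      omega
    have h4 : (d + t + 2).choose 3 = (q + 2).choose 3 + (d + t + 1).choose 2 := by
      rw [hq, Nat.choose_succ_succ' (q + 2) 2, add_comm]
    rw [hn, macUpper_two_of_le (by omega), h4]
    have h1 := two_mul_choose_two (t + b)
    have h2 := two_mul_choose_two d
    have h3 := two_mul_choose_two b
    have h5 := two_mul_choose_two (d + t)
    nlinarith [Nat.mul_le_mul_left t hdb.le]

lemma macUpper_two_superadditive (x y : ℕ) :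
    macUpper 2 x + macUpper 2 y ≤ macUpper 2 (x + y) := by
  induction y using Nat.strong_induction_on generalizing x with
  | _ y ih =>
    rcases Nat.eq_zero_or_pos y with rfl | hy
    · simp [macUpper_two_zero]
    · obtain ⟨j, k, h, hjk⟩ := exists_eq_choose_two_add (y - 1)
      have hy' : y = (k + 1).choose 2 + (j + 1) := by omega
      have h1 := ih ((k + 1).choose 2) (by omega) x
      have h2 := Nat.choose_le_choose 2 (show j + 1 ≤ k + 1 by omega)
      have h3 := choose_two_succ (j + 1)
      have h4 := macUpper_two_add_choose_le (n := x + (k + 1).choose 2) (d := j + 1) (by omega)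
      have h5 := macUpper_two_of_le (show j + 1 ≤ k + 1 by omega)
      have h6 := macUpper_two_of_lt (Nat.zero_le k)
      simp at h6
      rw [hy', show x + ((k + 1).choose 2 + (j + 1)) = x + (k + 1).choose 2 + (j + 1) by ring]
      omega

lemma exists_eq_add_single {ι : Type*} {w : ι →₀ ℕ} {x : ι} (h : w x ≠ 0) :
    ∃ v : ι →₀ ℕ, w = v + Finsupp.single x 1 :=
  ⟨w - Finsupp.single x 1, (tsub_add_cancel_of_le (Finsupp.single_le_iff.2 (by omega))).symm⟩

lemma degree_add_single {ι : Type*} (v : ι →₀ ℕ) (x : ι) :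
    (v + Finsupp.single x 1).degree = v.degree + 1 := by
  rw [map_add, Finsupp.degree_single]

lemma exists_apply_ne_zero_of_degree_pos {ι : Type*} {w : ι →₀ ℕ} (h : 0 < w.degree) :
    ∃ x, w x ≠ 0 := by
  by_contra! hw
  have : w = 0 := Finsupp.ext hw
  simp [this] at h

lemma eq_single_of_degree_eq_one {ι : Type*} {w : ι →₀ ℕ} {x : ι} (h : w.degree = 1)
    (hx : w x ≠ 0) : w = Finsupp.single x 1 := by
  obtain ⟨v, rfl⟩ := exists_eq_add_single hx
  rw [degree_add_single] at h
  rw [(Finsupp.degree_eq_zero_iff v).1 (by omega), zero_add]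

lemma eq_single_add_single_of_degree_eq_two {ι : Type*} {w : ι →₀ ℕ} {x y : ι}
    (h : w.degree = 2) (hx : w x ≠ 0) (hy : w y ≠ 0) (hxy : x ≠ y) :
    w = Finsupp.single y 1 + Finsupp.single x 1 := by
  obtain ⟨v, rfl⟩ := exists_eq_add_single hx
  rw [degree_add_single] at h
  rw [eq_single_of_degree_eq_one (w := v) (x := y) (by omega)]
  simpa [Finsupp.single_apply, hxy] using hy

open Finset in
lemma choose_two_le_card_of_le_card_filter {ι : Type*} (d : ℕ) (W : Finset (ι →₀ ℕ))
    (hdeg : ∀ w ∈ W, w.degree = 2) (hne : W.Nonempty)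
    (h : ∀ x, (∃ w ∈ W, w x ≠ 0) → d ≤ #{w ∈ W | w x ≠ 0}) : (d + 1).choose 2 ≤ #W := by
  classical
  induction d generalizing W with
  | zero => simp
  | succ d ih =>
    rcases Nat.eq_zero_or_pos d with rfl | hd
    · simpa using hne
    have hinter : ∀ x y, x ≠ y → #{w ∈ W | w x ≠ 0 ∧ w y ≠ 0} ≤ 1 := by
      intro x y hxy
      refine card_le_one.2 fun a ha b hb => ?_
      simp only [mem_filter] at ha hb
      rw [eq_single_add_single_of_degree_eq_two (hdeg a ha.1) ha.2.1 ha.2.2 hxy,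
        eq_single_add_single_of_degree_eq_two (hdeg b hb.1) hb.2.1 hb.2.2 hxy]
    obtain ⟨w, hw⟩ := hne
    obtain ⟨x, hx⟩ := exists_apply_ne_zero_of_degree_pos (w := w) (by rw [hdeg w hw]; norm_num)
    have hdx := h x ⟨w, hw, hx⟩
    have hsplit : ∀ y, y ≠ x → (∃ w ∈ W, w y ≠ 0) →
        d ≤ #{w ∈ {w ∈ W | w x = 0} | w y ≠ 0} := by
      intro y hyx hy
      have h1 := h y hy
      have h2 := hinter x y hyx.symm
      have h3 := card_filter_add_card_filter_not (s := {w ∈ W | w y ≠ 0}) (fun w => w x = 0)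
      rw [filter_filter, filter_filter] at h3
      rw [filter_filter]
      simp only [and_comm, ne_eq] at h1 h2 h3 ⊢
      omega
    have hne' : ({w ∈ W | w x = 0}).Nonempty := by
      obtain ⟨a, ha, b, hb, hab⟩ := one_lt_card.1 (show 1 < #{w ∈ W | w x ≠ 0} by omega)
      simp only [mem_filter] at ha hb
      have key : ∃ y, y ≠ x ∧ ∃ w ∈ W, w y ≠ 0 := by
        by_contra! hcon
        have hall : ∀ w ∈ W, w = Finsupp.single x 2 := by
          intro w hw
          have hw' : w = Finsupp.single x (w x) := by
            ext y
            rcases eq_or_ne y x with rfl | hyx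
            · simp
            · simp [hcon y hyx w hw, hyx]
          have h2 := hdeg w hw
          rw [hw', Finsupp.degree_single] at h2
          rw [hw', h2]
        exact hab ((hall a ha.1).trans (hall b hb.1).symm)
      obtain ⟨y, hyx, hy⟩ := key
      obtain ⟨w, hw⟩ := card_pos.1 (hd.trans_le (hsplit y hyx hy))
      exact ⟨w, (mem_filter.1 hw).1⟩
    have h4 := ih {w ∈ W | w x = 0} (fun w hw => hdeg w (mem_filter.1 hw).1) hne' (by
      rintro y ⟨w, hw, hy⟩
      rw [mem_filter] at hw
      exact hsplit y (by rintro rfl; exact hy hw.2) ⟨w, hw.1, hy⟩)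
    have h5 := card_filter_add_card_filter_not (s := W) (fun w => w x = 0)
    have h6 := choose_two_succ (d + 1)
    simp only [ne_eq] at hdx
    omega

open Finset in
lemma card_filter_le_choose_two {ι : Type*} {W T : Finset (ι →₀ ℕ)}
    (hdeg : ∀ u ∈ T, u.degree = 3)
    (h : ∀ u ∈ T, ∀ v x, u = v + Finsupp.single x 1 → v ∈ W) (x : ι) :
    #{u ∈ T | u x ≠ 0} ≤ (#{w ∈ W | w x ≠ 0} + 1).choose 2 := by
  classical
  rw [← card_sym2, ← card_image_of_injective _ (add_left_injective (Finsupp.single x 1))]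
  let F : Sym2 (ι →₀ ℕ) → (ι →₀ ℕ) := Sym2.lift ⟨fun a b => a + b, fun a b => add_comm a b⟩
  refine (card_le_card (t := ({w ∈ W | w x ≠ 0}).sym2.image F) ?_).trans card_image_le
  intro u' hu'
  obtain ⟨u, hu, rfl⟩ := mem_image.1 hu'
  obtain ⟨huT, hux⟩ := mem_filter.1 hu
  have h3 := hdeg u huT
  obtain ⟨v, rfl⟩ := exists_eq_add_single hux
  rw [degree_add_single] at h3
  obtain ⟨y, hy⟩ := exists_apply_ne_zero_of_degree_pos (w := v) (by omega)
  obtain ⟨v, rfl⟩ := exists_eq_add_single hy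
  rw [degree_add_single] at h3
  obtain ⟨z, hz⟩ := exists_apply_ne_zero_of_degree_pos (w := v) (by omega)
  obtain ⟨v, rfl⟩ := exists_eq_add_single hz
  rw [degree_add_single] at h3
  have hv : v = 0 := (Finsupp.degree_eq_zero_iff v).1 (by omega)
  subst hv
  rw [mem_image]
  refine ⟨s(Finsupp.single z 1 + Finsupp.single x 1, Finsupp.single y 1 + Finsupp.single x 1),
    ?_, ?_⟩
  · rw [mk_mem_sym2_iff, mem_filter, mem_filter]
    refine ⟨⟨h _ huT _ y (by abel), by simp⟩, ⟨h _ huT _ z (by abel), by simp⟩⟩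
  · simp only [F, Sym2.lift_mk]
    abel

open Finset in
lemma card_le_macUpper_two_of_degree_eq_three {ι : Type*} (W T : Finset (ι →₀ ℕ))
    (hW : ∀ w ∈ W, w.degree = 2) (hT : ∀ u ∈ T, u.degree = 3)
    (h : ∀ u ∈ T, ∀ v x, u = v + Finsupp.single x 1 → v ∈ W) : #T ≤ macUpper 2 #W := by
  classical
  induction hn : #W using Nat.strong_induction_on generalizing W T with
  | _ n ih =>
  subst hn
  rcases W.eq_empty_or_nonempty with rfl | hne
  · rcases T.eq_empty_or_nonempty with rfl | ⟨u, hu⟩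
    · simp
    · obtain ⟨x, hx⟩ := exists_apply_ne_zero_of_degree_pos (w := u) (by rw [hT u hu]; norm_num)
      obtain ⟨v, rfl⟩ := exists_eq_add_single hx
      exact absurd (h _ hu v x rfl) (by simp)
  have hex : ∃ d, ∃ x, (∃ w ∈ W, w x ≠ 0) ∧ #{w ∈ W | w x ≠ 0} = d := by
    obtain ⟨w, hw⟩ := hne
    obtain ⟨x, hx⟩ := exists_apply_ne_zero_of_degree_pos (w := w) (by rw [hW w hw]; norm_num)
    exact ⟨_, x, ⟨w, hw, hx⟩, rfl⟩
  obtain ⟨x, ⟨w, hw, hx⟩, hd⟩ := Nat.find_spec hex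
  have hmin : ∀ y, (∃ w ∈ W, w y ≠ 0) → #{w ∈ W | w x ≠ 0} ≤ #{w ∈ W | w y ≠ 0} := by
    intro y hy
    rw [hd]
    exact Nat.find_min' hex ⟨y, hy, rfl⟩
  have h1 := choose_two_le_card_of_le_card_filter _ W hW hne hmin
  have h2 := card_filter_le_choose_two hT h x
  have h3 := card_filter_add_card_filter_not (s := W) (fun w => w x = 0)
  have h4 := card_filter_add_card_filter_not (s := T) (fun w => w x = 0)
  have hpos : 0 < #{w ∈ W | w x ≠ 0} := card_pos.2 ⟨w, mem_filter.2 ⟨hw, hx⟩⟩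
  simp only [ne_eq] at *
  have h5 := ih #{w ∈ W | w x = 0} (by omega) {w ∈ W | w x = 0} {u ∈ T | u x = 0}
    (fun w hw => hW w (mem_filter.1 hw).1) (fun u hu => hT u (mem_filter.1 hu).1) (by
      rintro u hu v y rfl
      rw [mem_filter] at hu ⊢
      exact ⟨h _ hu.1 v y rfl, by simpa using (Nat.add_eq_zero_iff.1 hu.2).1⟩) rfl
  have h6 := macUpper_two_add_choose_le (n := #{w ∈ W | w x = 0}) (d := #{w ∈ W | ¬ w x = 0})
    (by omega)
  rw [h3] at h6
  omega

open Finset in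
lemma card_le_macUpper_two_of_degree_eq {ι : Type*} (d : ℕ) (W T : Finset (ι →₀ ℕ))
    (hT : ∀ u ∈ T, u.degree = d + 3)
    (h : ∀ u ∈ T, ∀ v x, u = v + Finsupp.single x 1 → v ∈ W)
    (hW : ∀ w ∈ W, w.degree = d + 2) : #T ≤ macUpper 2 #W := by
  classical
  induction d generalizing W T with
  | zero => exact card_le_macUpper_two_of_degree_eq_three W T hW hT h
  | succ d ihd =>
    induction hn : #W using Nat.strong_induction_on generalizing W T with
    | _ n ih =>
    subst hn
    rcases W.eq_empty_or_nonempty with rfl | ⟨w, hw⟩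
    · rcases T.eq_empty_or_nonempty with rfl | ⟨u, hu⟩
      · simp
      · obtain ⟨x, hx⟩ := exists_apply_ne_zero_of_degree_pos (w := u) (by rw [hT u hu]; omega)
        obtain ⟨v, rfl⟩ := exists_eq_add_single hx
        exact absurd (h _ hu v x rfl) (by simp)
    obtain ⟨x, hx⟩ := exists_apply_ne_zero_of_degree_pos (w := w) (by rw [hW w hw]; omega)
    have h3 := card_filter_add_card_filter_not (s := W) (fun w => w x = 0)
    have h4 := card_filter_add_card_filter_not (s := T) (fun w => w x = 0)
    have hpos : 0 < #{w ∈ W | ¬ w x = 0} := card_pos.2 ⟨w, mem_filter.2 ⟨hw, hx⟩⟩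
    have h5 := ih #{w ∈ W | w x = 0} (by omega) {w ∈ W | w x = 0} {u ∈ T | u x = 0}
      (fun u hu => hT u (mem_filter.1 hu).1) (by
        rintro u hu v y rfl
        rw [mem_filter] at hu ⊢
        exact ⟨h _ hu.1 v y rfl, by simpa using (Nat.add_eq_zero_iff.1 hu.2).1⟩)
      (fun w hw => hW w (mem_filter.1 hw).1) rfl
    have hdiv : ∀ S : Finset (ι →₀ ℕ), ∃ S' : Finset (ι →₀ ℕ), #S' = #{u ∈ S | ¬ u x = 0} ∧
        ∀ v, v ∈ S' ↔ v + Finsupp.single x 1 ∈ S := by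
      intro S
      refine ⟨S.preimage (· + Finsupp.single x 1) (add_left_injective _).injOn, ?_, by simp⟩
      rw [card_preimage]
      congr 1
      ext u
      simp only [mem_filter, Set.mem_range]
      refine and_congr_right fun _ => ⟨?_, fun hu => ?_⟩
      · rintro ⟨v, rfl⟩
        simp
      · obtain ⟨v, rfl⟩ := exists_eq_add_single hu
        exact ⟨v, rfl⟩
    obtain ⟨W', hW'c, hW'⟩ := hdiv W
    obtain ⟨T', hT'c, hT'⟩ := hdiv T
    have h6 := ihd W' T' (fun u hu => by
        have := hT _ ((hT' u).1 hu)
        rw [degree_add_single] at this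
        omega) (by
        rintro u hu v y rfl
        rw [hT'] at hu
        rw [hW']
        exact h _ hu _ y (by abel)) (fun u hu => by
        have := hW _ ((hW' u).1 hu)
        rw [degree_add_single] at this
        omega)
    have h7 := macUpper_two_superadditive #{w ∈ W | w x = 0} #{w ∈ W | ¬ w x = 0}
    rw [h3] at h7
    rw [hT'c, hW'c] at h6
    omega

open Finset in
/-- Macaulay's bound with all degrees at once: a finite set of monomials of degree at least three
whose maximal proper divisors lie in `W` has at most `macUpper 2 #W` elements. -/
lemma card_le_macUpper_two {ι : Type*} (W T : Finset (ι →₀ ℕ))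
    (hT : ∀ u ∈ T, 3 ≤ u.degree)
    (h : ∀ u ∈ T, ∀ v x, u = v + Finsupp.single x 1 → v ∈ W) : #T ≤ macUpper 2 #W := by
  classical
  suffices hD : ∀ D, #{u ∈ T | u.degree < D + 3} ≤ macUpper 2 #{w ∈ W | w.degree < D + 2} by
    refine le_trans (card_le_card fun u hu => ?_) ((hD (∑ u ∈ T, u.degree)).trans
      (macUpper_two_mono (card_filter_le _ _)))
    have : u.degree ≤ ∑ u ∈ T, u.degree :=
      single_le_sum (f := fun u : ι →₀ ℕ => u.degree) (fun _ _ => Nat.zero_le _) hu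
    exact mem_filter.2 ⟨hu, by omega⟩
  intro D
  induction D with
  | zero =>
    rw [filter_false_of_mem fun u hu => by have := hT u hu; omega]
    simp
  | succ D ih =>
    have h1 := card_le_macUpper_two_of_degree_eq D {w ∈ W | w.degree = D + 2}
      {u ∈ T | u.degree = D + 3} (by simp) (by
        rintro u hu v x rfl
        rw [mem_filter, degree_add_single] at hu
        exact mem_filter.2 ⟨h _ hu.1 v x rfl, by omega⟩) (by simp)
    have hs : ∀ (S : Finset (ι →₀ ℕ)) (n : ℕ),
        #{u ∈ S | u.degree < n + 1} = #{u ∈ S | u.degree < n} + #{u ∈ S | u.degree = n} := by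
      intro S n
      rw [← card_union_of_disjoint (disjoint_filter.2 fun u _ h1 h2 => by omega), ← filter_or]
      congr 1
      ext u
      simp only [mem_filter]
      refine and_congr_right fun _ => by omega
    have h2 := macUpper_two_superadditive #{w ∈ W | w.degree < D + 2} #{w ∈ W | w.degree = D + 2}
    have h3 := hs T (D + 3)
    have h4 := hs W (D + 2)
    rw [show D + 1 + 3 = D + 3 + 1 by ring, show D + 1 + 2 = D + 2 + 1 by ring, h3, h4]
    omega

section Factorizations

variable {Γ : AddSubmonoid ℕ}

lemma factorizationHom_single (g : minGens Γ) (n : ℕ) :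
    factorizationHom Γ (Finsupp.single g n) = g * n := by
  simp [factorizationHom]

lemma factorizationHom_add_single (v : minGens Γ →₀ ℕ) (g : minGens Γ) :
    factorizationHom Γ (v + Finsupp.single g 1) = factorizationHom Γ v + g := by
  rw [map_add, factorizationHom_single, mul_one]

lemma minGens_pos (g : minGens Γ) : 0 < (g : ℕ) :=
  Nat.pos_of_ne_zero g.2.2.1

lemma le_factorizationHom (v : minGens Γ →₀ ℕ) (g : minGens Γ) : v g ≤ factorizationHom Γ v := by
  rw [← tsub_add_cancel_of_le (Finsupp.single_le_iff.2 le_rfl : Finsupp.single g (v g) ≤ v),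
    map_add, factorizationHom_single]
  simpa using le_add_left (Nat.le_mul_of_pos_left (v g) (minGens_pos g))

lemma eq_zero_of_factorizationHom_eq_zero {v : minGens Γ →₀ ℕ} (h : factorizationHom Γ v = 0) :
    v = 0 := by
  ext g
  simpa [h] using le_factorizationHom v g

lemma factorizationHom_mem (v : minGens Γ →₀ ℕ) : factorizationHom Γ v ∈ Γ := by
  induction v using Finsupp.induction_linear with
  | zero => simp [Γ.zero_mem]
  | add u v hu hv => rw [map_add]; exact Γ.add_mem hu hv
  | single g n =>
    rw [factorizationHom_single, mul_comm, ← smul_eq_mul]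
    exact Γ.nsmul_mem g.2.1 n

lemma eq_single_of_factorizationHom_eq {v : minGens Γ →₀ ℕ} {g : minGens Γ}
    (h : factorizationHom Γ v = g) : v = Finsupp.single g 1 := by
  obtain ⟨x, hx⟩ : ∃ x, v x ≠ 0 := by
    by_contra! hv
    rw [Finsupp.ext hv (g := 0), map_zero] at h
    exact (minGens_pos g).ne h
  obtain ⟨v, rfl⟩ := exists_eq_add_single hx
  rw [factorizationHom_add_single] at h
  have h0 : factorizationHom Γ v = 0 := by
    by_contra h0
    exact g.2.2.2 _ (factorizationHom_mem v) x x.2.1 h0 (minGens_pos x).ne' h.symm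
  rw [eq_zero_of_factorizationHom_eq_zero h0, zero_add]
  rw [h0, zero_add] at h
  rw [Subtype.ext h]

lemma exists_factorizationHom_eq {n : ℕ} (hn : n ∈ Γ) : ∃ v, factorizationHom Γ v = n := by
  induction n using Nat.strong_induction_on with
  | _ n ih =>
    rcases eq_or_ne n 0 with rfl | h0
    · exact ⟨0, map_zero _⟩
    by_cases hg : n ∈ minGens Γ
    · exact ⟨Finsupp.single ⟨n, hg⟩ 1, by rw [factorizationHom_single, mul_one]⟩
    · simp only [minGens, Set.mem_ofPred_eq, not_and, not_forall, not_not] at hg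
      obtain ⟨a, ha, b, hb, ha0, hb0, hab⟩ := hg hn h0
      obtain ⟨u, hu⟩ := ih a (by omega) ha
      obtain ⟨v, hv⟩ := ih b (by omega) hb
      exact ⟨u + v, by rw [map_add, hu, hv, hab]⟩

/-- A factorization is normal if it is the lexicographically largest one of its value. -/
def IsNormal (u : minGens Γ →₀ ℕ) : Prop :=
  ∀ v, factorizationHom Γ v = factorizationHom Γ u → toLex v ≤ toLex u

/-- The factorizations which are minimal among those that are not normal. -/
def corners (Γ : AddSubmonoid ℕ) : Set (minGens Γ →₀ ℕ) :=
  {c | ¬ IsNormal c ∧ ∀ v x, c = v + Finsupp.single x 1 → IsNormal v}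

lemma IsNormal.eq {u v : minGens Γ →₀ ℕ} (hu : IsNormal u) (hv : IsNormal v)
    (h : factorizationHom Γ u = factorizationHom Γ v) : u = v :=
  toLex.injective ((hv u h).antisymm (hu v h.symm))

lemma IsNormal.of_add {u w : minGens Γ →₀ ℕ} (h : IsNormal (u + w)) : IsNormal u := by
  intro v hv
  have := h (v + w) (by rw [map_add, map_add, hv])
  rwa [toLex_add, toLex_add, add_le_add_iff_right] at this

lemma isNormal_zero : IsNormal (0 : minGens Γ →₀ ℕ) := by
  intro v hv
  rw [eq_zero_of_factorizationHom_eq_zero (hv.trans (map_zero _))]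

lemma isNormal_single (g : minGens Γ) : IsNormal (Finsupp.single g 1) := by
  intro v hv
  rw [eq_single_of_factorizationHom_eq (hv.trans (by rw [factorizationHom_single, mul_one]))]

lemma finite_setOf_factorizationHom_eq [Finite (minGens Γ)] (n : ℕ) :
    {v | factorizationHom Γ v = n}.Finite := by
  refine (Set.finite_Iic (Finsupp.equivFunOnFinite.symm fun _ : minGens Γ => n)).subset ?_
  rintro v rfl
  exact fun g => by simpa using le_factorizationHom v g

lemma exists_isNormal [Finite (minGens Γ)] (u : minGens Γ →₀ ℕ) :
    ∃ v, factorizationHom Γ v = factorizationHom Γ u ∧ IsNormal v := by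
  obtain ⟨v, hv, hmax⟩ := Set.exists_max_image _ toLex
    (finite_setOf_factorizationHom_eq (factorizationHom Γ u)) ⟨u, rfl⟩
  exact ⟨v, hv, fun w hw => hmax w (hw.trans hv)⟩

lemma exists_corner_add_eq (u : minGens Γ →₀ ℕ) (hu : ¬ IsNormal u) :
    ∃ c ∈ corners Γ, ∃ r, u = c + r := by
  induction hn : u.degree generalizing u with
  | zero => exact absurd isNormal_zero ((Finsupp.degree_eq_zero_iff u).1 hn ▸ hu)
  | succ n ih =>
    by_cases hc : u ∈ corners Γ
    · exact ⟨u, hc, 0, (add_zero u).symm⟩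
    · simp only [corners, Set.mem_ofPred_eq, not_and, not_forall] at hc
      obtain ⟨v, x, rfl, hv⟩ := hc hu
      rw [degree_add_single] at hn
      obtain ⟨c, hc', r, rfl⟩ := ih v hv (by omega)
      exact ⟨c, hc', r + Finsupp.single x 1, add_assoc _ _ _⟩

lemma addConGen_corners [Finite (minGens Γ)] {nf : (minGens Γ →₀ ℕ) → (minGens Γ →₀ ℕ)}
    (hnf : ∀ u, factorizationHom Γ (nf u) = factorizationHom Γ u ∧ IsNormal (nf u)) :
    addConGen (fun a b => (a, b) ∈ (fun c => (c, nf c)) '' corners Γ) =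
      AddCon.ker (factorizationHom Γ) := by
  set G := addConGen (fun a b => (a, b) ∈ (fun c => (c, nf c)) '' corners Γ) with hG
  apply le_antisymm
  · rw [hG, AddCon.addConGen_le]
    rintro a b ⟨c, -, h⟩
    obtain ⟨rfl, rfl⟩ := Prod.mk.inj h
    exact (hnf _).1.symm
  · have key : ∀ a, G a (nf a) := by
      intro a
      obtain ⟨v, ⟨hv, hav⟩, hmax⟩ := Set.exists_max_image
        {v | factorizationHom Γ v = factorizationHom Γ a ∧ G a v} toLex
        ((finite_setOf_factorizationHom_eq (factorizationHom Γ a)).subset fun v hv => hv.1)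
        ⟨a, rfl, G.refl a⟩
      have hN : IsNormal v := by
        by_contra hN
        obtain ⟨c, hc, r, rfl⟩ := exists_corner_add_eq v hN
        have hrel : G c (nf c) := AddCon.addConGen_le.1 hG.ge _ _ (Set.mem_image_of_mem _ hc)
        have hcr : G (c + r) (nf c + r) := G.add hrel (G.refl r)
        have h1 := hmax (nf c + r)
          ⟨by rw [← hv, map_add, map_add, (hnf c).1], G.trans hav hcr⟩
        rw [toLex_add, toLex_add, add_le_add_iff_right] at h1
        refine hc.1 fun w hw => ((hnf c).2 w (hw.trans (hnf c).1.symm)).trans h1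
      rwa [hN.eq (hnf a).2 (hv.trans (hnf a).1.symm)] at hav
    intro a b hab
    have hab' : factorizationHom Γ a = factorizationHom Γ b := hab
    have h := (hnf a).2.eq (hnf b).2 ((hnf a).1.trans (hab'.trans (hnf b).1.symm))
    exact G.trans (key a) (h ▸ G.symm (key b))

lemma exists_generating_ncard_le [Finite (minGens Γ)] (hfin : (corners Γ).Finite) :
    ∃ R : Set ((minGens Γ →₀ ℕ) × (minGens Γ →₀ ℕ)), R.Finite ∧ R.ncard ≤ (corners Γ).ncard ∧
      addConGen (fun a b => (a, b) ∈ R) = AddCon.ker (factorizationHom Γ) := by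
  choose nf hnf using exists_isNormal (Γ := Γ)
  exact ⟨_, hfin.image _, Set.ncard_image_le hfin, addConGen_corners hnf⟩

lemma rho_le_ncard_corners [Finite (minGens Γ)] (hfin : (corners Γ).Finite) :
    rho Γ ≤ (corners Γ).ncard := by
  obtain ⟨R, hR, hle, hgen⟩ := exists_generating_ncard_le hfin
  rw [rho]
  exact le_trans (Nat.sInf_le ⟨R, hR, rfl, hgen⟩) hle

section LeastGenerator

variable {g₀ : minGens Γ}

lemma toLex_lt_of_apply_lt (hg : ∀ g, g₀ ≤ g) {u v : minGens Γ →₀ ℕ} (h : u g₀ < v g₀) :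
    toLex u < toLex v :=
  Finsupp.Lex.lt_iff.2 ⟨g₀, fun g hlt => absurd hlt (hg g).not_gt, h⟩

lemma apply_eq_zero_of_mem_corners (hg : ∀ g, g₀ ≤ g) {c : minGens Γ →₀ ℕ} (hc : c ∈ corners Γ) :
    c g₀ = 0 := by
  by_contra h
  obtain ⟨v, rfl⟩ := exists_eq_add_single h
  have hv := hc.2 v g₀ rfl
  refine hc.1 fun w hw => ?_
  by_cases hw0 : w g₀ = 0
  · exact (toLex_lt_of_apply_lt hg (by rw [hw0]; exact Nat.pos_of_ne_zero h)).le
  · obtain ⟨w, rfl⟩ := exists_eq_add_single hw0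
    rw [factorizationHom_add_single, factorizationHom_add_single] at hw
    rw [toLex_add, toLex_add, add_le_add_iff_right]
    exact hv w (by omega)

lemma IsNormal.eq_of_mod_eq (hg : ∀ g, g₀ ≤ g) {u v : minGens Γ →₀ ℕ} (hu : IsNormal u)
    (hv : IsNormal v) (hu0 : u g₀ = 0) (hv0 : v g₀ = 0)
    (h : factorizationHom Γ u % g₀ = factorizationHom Γ v % g₀) : u = v := by
  wlog hle : factorizationHom Γ u ≤ factorizationHom Γ v generalizing u v
  · exact (this hv hu hv0 hu0 h.symm (le_of_not_ge hle)).symm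
  obtain ⟨k, hk⟩ := (Nat.modEq_iff_dvd' hle).1 h
  have hk' : factorizationHom Γ (u + Finsupp.single g₀ k) = factorizationHom Γ v := by
    rw [map_add, factorizationHom_single, ← hk]
    omega
  rcases Nat.eq_zero_or_pos k with rfl | hkpos
  · exact hu.eq hv (by simpa using hk')
  · refine absurd (hv _ hk') (toLex_lt_of_apply_lt hg ?_).not_ge
    simpa [hu0, hv0] using hkpos

lemma finite_setOf_isNormal (hg : ∀ g, g₀ ≤ g) :
    {u : minGens Γ →₀ ℕ | IsNormal u ∧ u g₀ = 0}.Finite ∧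
      {u : minGens Γ →₀ ℕ | IsNormal u ∧ u g₀ = 0}.ncard ≤ g₀ := by
  have hmaps : Set.MapsTo (fun u => factorizationHom Γ u % g₀)
      {u : minGens Γ →₀ ℕ | IsNormal u ∧ u g₀ = 0} (Set.Iio (g₀ : ℕ)) :=
    fun u _ => Nat.mod_lt _ (minGens_pos g₀)
  have hinj : Set.InjOn (fun u => factorizationHom Γ u % g₀)
      {u : minGens Γ →₀ ℕ | IsNormal u ∧ u g₀ = 0} :=
    fun u hu v hv h => hu.1.eq_of_mod_eq hg hv.1 hu.2 hv.2 h
  refine ⟨(Set.finite_Iio (g₀ : ℕ)).of_injOn hmaps hinj, ?_⟩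
  simpa [Set.ncard_eq_toFinset_card'] using
    Set.ncard_le_ncard_of_injOn _ hmaps hinj (Set.finite_Iio (g₀ : ℕ))

end LeastGenerator

end Factorizations

open Finset in
/-- The monomials of degree two in the variables from `S`. -/
lemma exists_finset_degree_two {ι : Type*} (S : Finset ι) :
    ∃ P : Finset (ι →₀ ℕ), #P = (#S + 1).choose 2 ∧
      ∀ u, u ∈ P ↔ u.degree = 2 ∧ ∀ x, u x ≠ 0 → x ∈ S := by
  classical
  let F : Sym2 ι → (ι →₀ ℕ) := Sym2.lift
    ⟨fun a b => Finsupp.single a 1 + Finsupp.single b 1, fun a b => add_comm _ _⟩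
  have hF : Function.Injective F := by
    intro p q
    induction p with | _ a b
    induction q with | _ c d
    intro h
    simp only [F, Sym2.lift_mk,
      Finsupp.single_add_single_eq_single_add_single one_ne_zero one_ne_zero] at h
    rw [Sym2.eq_iff]
    rcases h with h | ⟨-, h⟩ | ⟨h, -⟩
    · exact Or.inl h
    · exact Or.inr h
    · exact absurd h (by norm_num)
  refine ⟨S.sym2.image F, by rw [card_image_of_injective _ hF, card_sym2], fun u => ?_⟩
  rw [mem_image]
  constructor
  · rintro ⟨p, hp, rfl⟩
    induction p with | _ a b
    rw [mk_mem_sym2_iff] at hp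
    refine ⟨by simp [F, Finsupp.degree_single], fun x hx => ?_⟩
    simp only [F, Sym2.lift_mk, Finsupp.add_apply, Finsupp.single_apply] at hx
    by_cases h1 : a = x
    · exact h1 ▸ hp.1
    · by_cases h2 : b = x
      · exact h2 ▸ hp.2
      · simp [h1, h2] at hx
  · rintro ⟨hu, hS⟩
    obtain ⟨x, hx⟩ := exists_apply_ne_zero_of_degree_pos (w := u) (by omega)
    obtain ⟨v, rfl⟩ := exists_eq_add_single hx
    rw [degree_add_single] at hu
    obtain ⟨y, hy⟩ := exists_apply_ne_zero_of_degree_pos (w := v) (by omega)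
    refine ⟨s(y, x), ?_, ?_⟩
    · rw [mk_mem_sym2_iff]
      exact ⟨hS y (by simp [hy]), hS x hx⟩
    · simp only [F, Sym2.lift_mk]
      rw [eq_single_of_degree_eq_one (by omega) hy]

section UpperBound

variable {Γ : AddSubmonoid ℕ} {g₀ : minGens Γ}

lemma two_le_degree_of_mem_corners {c : minGens Γ →₀ ℕ} (hc : c ∈ corners Γ) : 2 ≤ c.degree := by
  by_contra! h
  refine hc.1 ?_
  rcases Nat.eq_zero_or_pos c.degree with h0 | h0
  · rw [(Finsupp.degree_eq_zero_iff c).1 h0]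
    exact isNormal_zero
  · obtain ⟨x, hx⟩ := exists_apply_ne_zero_of_degree_pos h0
    rw [eq_single_of_degree_eq_one (by omega) hx]
    exact isNormal_single x

open Finset in
lemma ncard_corners_add_le [Finite (minGens Γ)] (hg : ∀ g, g₀ ≤ g) {e s : ℕ}
    (he : Nat.card (minGens Γ) = e + 1) (hs : e + 1 + s = g₀) :
    (corners Γ).Finite ∧ (corners Γ).ncard + s ≤ (e + 1).choose 2 + macUpper 2 s := by
  classical
  have := Fintype.ofFinite (minGens Γ)
  rw [Nat.card_eq_fintype_card] at he
  obtain ⟨hAfin, hAcard⟩ := finite_setOf_isNormal hg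
  obtain ⟨A, hA⟩ : ∃ A : Finset (minGens Γ →₀ ℕ), ∀ u, u ∈ A ↔ IsNormal u ∧ u g₀ = 0 :=
    ⟨hAfin.toFinset, by simp⟩
  have hAc : #A ≤ g₀ := by
    rw [← Set.ncard_coe_finset]
    convert hAcard using 2
    ext u
    simp [hA]
  have hlow : e + 1 ≤ #{u ∈ A | ¬ 2 ≤ u.degree} := by
    rw [← he, ← card_univ]
    refine card_le_card_of_injOn (fun g => if g = g₀ then 0 else Finsupp.single g 1) ?_ ?_
    · intro g _
      rw [mem_coe, mem_filter, hA]
      by_cases h : g = g₀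
      · simp [h, isNormal_zero]
      · simp [h, isNormal_single, Finsupp.degree_single]
    · intro a _ b _ hab
      simp only at hab
      split_ifs at hab with h1 h2 h2
      · rw [h1, h2]
      · exact absurd hab.symm (by simp)
      · exact absurd hab (by simp)
      · exact Finsupp.single_left_injective one_ne_zero hab
  have hsplit := card_filter_add_card_filter_not (s := A) (fun u => 2 ≤ u.degree)
  set N := {u ∈ A | 2 ≤ u.degree} with hN
  have hNs : #N ≤ s := by omega
  obtain ⟨P, hPc, hP⟩ := exists_finset_degree_two (univ.erase g₀)
  rw [card_erase_of_mem (mem_univ _), card_univ, he, Nat.add_sub_cancel] at hPc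
  obtain ⟨T, hT⟩ : ∃ T : Finset (minGens Γ →₀ ℕ), ∀ u, u ∈ T ↔
      3 ≤ u.degree ∧ u g₀ = 0 ∧ ∀ v x, u = v + Finsupp.single x 1 → IsNormal v := by
    have hTN : {u : minGens Γ →₀ ℕ | 3 ≤ u.degree ∧ u g₀ = 0 ∧
        ∀ v x, u = v + Finsupp.single x 1 → IsNormal v}.Finite := by
      refine (A.finite_toSet.image2 (· + ·)
        (Set.finite_range fun x : minGens Γ => Finsupp.single x 1)).subset ?_
      rintro u ⟨h3, h0, h⟩
      obtain ⟨x, hx⟩ := exists_apply_ne_zero_of_degree_pos (w := u) (by omega)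
      obtain ⟨v, rfl⟩ := exists_eq_add_single hx
      exact ⟨v, (hA v).2 ⟨h v x rfl, (Nat.add_eq_zero_iff.1 h0).1⟩, _, ⟨x, rfl⟩, rfl⟩
    exact ⟨hTN.toFinset, by simp⟩
  have hTc : #T ≤ macUpper 2 #N := by
    refine card_le_macUpper_two N T (fun u hu => ((hT u).1 hu).1) ?_
    rintro u hu v x rfl
    obtain ⟨h3, h0, h⟩ := (hT _).1 hu
    rw [degree_add_single] at h3
    exact mem_filter.2 ⟨(hA v).2 ⟨h v x rfl, (Nat.add_eq_zero_iff.1 h0).1⟩, by omega⟩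
  have hPT : ∀ u : minGens Γ →₀ ℕ, 2 ≤ u.degree → u g₀ = 0 →
      (∀ v x, u = v + Finsupp.single x 1 → IsNormal v) → u ∈ P ∪ T := by
    intro u h2 h0 h
    rw [mem_union, hP, hT]
    rcases h2.eq_or_lt with h2 | h2
    · exact Or.inl ⟨h2.symm, fun x hx => mem_erase.2 ⟨by rintro rfl; exact hx h0, mem_univ _⟩⟩
    · exact Or.inr ⟨h2, h0, h⟩
  have hCPT : ∀ c ∈ corners Γ, c ∈ P ∪ T := fun c hc =>
    hPT c (two_le_degree_of_mem_corners hc) (apply_eq_zero_of_mem_corners hg hc) hc.2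
  have hCfin : (corners Γ).Finite := (P ∪ T).finite_toSet.subset fun c hc => hCPT c hc
  refine ⟨hCfin, ?_⟩
  have hdisj : Disjoint hCfin.toFinset N := by
    rw [Finset.disjoint_left]
    intro c hc hcN
    exact (hCfin.mem_toFinset.1 hc).1 ((hA c).1 (mem_filter.1 hcN).1).1
  have hsub : hCfin.toFinset ∪ N ⊆ P ∪ T := by
    intro u hu
    rcases mem_union.1 hu with hu | hu
    · exact hCPT u (hCfin.mem_toFinset.1 hu)
    · obtain ⟨huA, h2⟩ := mem_filter.1 hu
      obtain ⟨hn, h0⟩ := (hA u).1 huA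
      refine hPT u h2 h0 ?_
      rintro v x rfl
      exact hn.of_add
  have h1 := card_le_card hsub
  rw [card_union_of_disjoint hdisj] at h1
  have h2 := card_union_le P T
  have h3 := macUpper_two_add_le #N (s - #N)
  rw [Nat.add_sub_cancel' hNs] at h3
  rw [Set.ncard_eq_toFinset_card _ hCfin]
  omega

end UpperBound

lemma mult_mem_minGens {Γ : AddSubmonoid ℕ} (h : (minGens Γ).Nonempty) : mult Γ ∈ minGens Γ := by
  obtain ⟨g, hg⟩ := h
  have hne : {g : ℕ | g ∈ Γ ∧ g ≠ 0}.Nonempty := ⟨g, hg.1, hg.2.1⟩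
  obtain ⟨h1, h2⟩ := Nat.sInf_mem hne
  refine ⟨h1, h2, fun a ha b hb ha0 hb0 hab => ?_⟩
  have : mult Γ ≤ a := Nat.sInf_le ⟨ha, ha0⟩
  omega

lemma mult_le_of_mem {Γ : AddSubmonoid ℕ} {g : ℕ} (h : g ∈ Γ) (h0 : g ≠ 0) : mult Γ ≤ g :=
  Nat.sInf_le ⟨h, h0⟩

/-- The number of minimal relations when the Apéry set has `s` elements besides zero and the
minimal generators. -/
lemma rho_add_le {Γ : AddSubmonoid ℕ} {e s : ℕ} (he : edim Γ = e + 1) (hm : mult Γ = e + 1 + s) :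
    (corners Γ).Finite ∧ rho Γ + s ≤ (e + 1).choose 2 + macUpper 2 s := by
  have hfin : (minGens Γ).Finite := Set.finite_of_ncard_ne_zero (by rw [← edim]; omega)
  have hne : (minGens Γ).Nonempty := Set.nonempty_of_ncard_ne_zero (by rw [← edim]; omega)
  have : Finite (minGens Γ) := hfin
  obtain ⟨h1, h2⟩ := ncard_corners_add_le (g₀ := ⟨mult Γ, mult_mem_minGens hne⟩)
    (fun g => mult_le_of_mem g.2.1 g.2.2.1) he hm.symm
  exact ⟨h1, (Nat.add_le_add_right (rho_le_ncard_corners h1) s).trans h2⟩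

lemma mathcalC_add_eq {e s : ℕ} (hs : s < (e + 1).choose 2) :
    mathcalC e (e + 1 + s) = (e + 1).choose 2 + macUpper 2 s - s := by
  have hR : macR e (e + 1 + s) = 2 := by
    rw [macR]
    refine IsLeast.csInf_eq ⟨⟨two_pos, ?_⟩, ?_⟩
    · rw [choose_two_succ (e + 1)]
      omega
    · rintro r ⟨h0, hr⟩
      by_contra! hlt
      obtain rfl : r = 1 := by omega
      simp at hr
      omega
  rw [mathcalC, hR]
  simp

open Finset in
/-- Factorizations all of whose proper divisors are the only factorizations of their values
contribute independent relations. -/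
lemma card_le_rho {Γ : AddSubmonoid ℕ} [Finite (minGens Γ)] (hfin : (corners Γ).Finite)
    (C : Finset (minGens Γ →₀ ℕ))
    (huniq : ∀ c ∈ C, ∀ u x, c = u + Finsupp.single x 1 →
      ∀ v, factorizationHom Γ v = factorizationHom Γ u → v = u)
    (hother : ∀ c ∈ C, ∃ v, factorizationHom Γ v = factorizationHom Γ c ∧ v ∉ C) :
    #C ≤ rho Γ := by
  classical
  obtain ⟨R₀, hR₀, -, hgen₀⟩ := exists_generating_ncard_le hfin
  refine le_csInf ⟨_, R₀, hR₀, rfl, hgen₀⟩ ?_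
  rintro n ⟨R, hR, rfl, hgen⟩
  let ψ : (minGens Γ →₀ ℕ) → (C → ℚ) := fun u c => if u = c then 1 else 0
  have hψ : ∀ u ∉ C, ψ u = 0 := fun u hu => funext fun c =>
    if_neg fun h : u = c => hu (h ▸ c.2)
  let D : Finset (C → ℚ) := hR.toFinset.image fun p => ψ p.1 - ψ p.2
  let W := Submodule.span ℚ (D : Set (C → ℚ))
  have hproper : ∀ a b c, factorizationHom Γ a = factorizationHom Γ b → c ≠ 0 → a + c ∈ C →
      a = b := by
    intro a b c hab hc hac
    obtain ⟨x, hx⟩ : ∃ x, c x ≠ 0 := by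
      by_contra! h
      exact hc (Finsupp.ext h)
    obtain ⟨c, rfl⟩ := exists_eq_add_single hx
    have := huniq _ hac (a + c) x (add_assoc _ _ _).symm (b + c) (by rw [map_add, map_add, hab])
    exact (add_right_cancel this).symm
  have htrans : ∀ a b c, factorizationHom Γ a = factorizationHom Γ b → ψ a - ψ b ∈ W →
      ψ (a + c) - ψ (b + c) ∈ W := by
    intro a b c hab hW
    rcases eq_or_ne c 0 with rfl | hc
    · simpa using hW
    · rcases eq_or_ne a b with rfl | hne
      · simp
      · rw [hψ _ fun h => hne (hproper a b c hab hc h),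
          hψ _ fun h => hne (hproper b a c hab.symm hc h).symm, sub_zero]
        exact W.zero_mem
  let K : AddCon (minGens Γ →₀ ℕ) :=
    { r := fun a b => factorizationHom Γ a = factorizationHom Γ b ∧ ψ a - ψ b ∈ W
      iseqv :=
        { refl := fun a => ⟨rfl, by simp⟩
          symm := fun h => ⟨h.1.symm, by simpa using W.neg_mem h.2⟩
          trans := fun h₁ h₂ => ⟨h₁.1.trans h₂.1, by simpa using W.add_mem h₁.2 h₂.2⟩ }
      add' := by
        intro a b c d hab hcd
        refine ⟨by rw [map_add, map_add, hab.1, hcd.1], ?_⟩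
        have h1 := htrans a b c hab.1 hab.2
        have h2 := htrans c d b hcd.1 hcd.2
        rw [add_comm c b, add_comm d b] at h2
        simpa using W.add_mem h1 h2 }
  have hle : AddCon.ker (factorizationHom Γ) ≤ K := by
    rw [← hgen, AddCon.addConGen_le]
    intro a b hab
    refine ⟨AddCon.addConGen_le.1 hgen.le _ _ hab, Submodule.subset_span ?_⟩
    exact mem_coe.2 (mem_image.2 ⟨(a, b), hR.mem_toFinset.2 hab, rfl⟩)
  have htop : W = ⊤ := by
    rw [eq_top_iff, ← (Pi.basisFun ℚ C).span_eq, Submodule.span_le]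
    rintro _ ⟨c, rfl⟩
    obtain ⟨v, hv, hvC⟩ := hother c c.2
    have h1 : ψ c - ψ v ∈ W := (hle (show AddCon.ker (factorizationHom Γ) c v from hv.symm)).2
    rw [hψ v hvC, sub_zero] at h1
    have h2 : Pi.basisFun ℚ C c = ψ c := by
      ext d
      rcases eq_or_ne d c with rfl | h
      · simp [ψ]
      · simp [ψ, h, Subtype.coe_ne_coe.2 h.symm]
    rwa [SetLike.mem_coe, h2]
  have h1 : Module.finrank ℚ W ≤ #D := finrank_span_finset_le_card D
  rw [htop, finrank_top, Module.finrank_fintype_fun_eq_card, Fintype.card_coe] at h1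
  rw [Set.ncard_eq_toFinset_card _ hR]
  exact h1.trans card_image_le

section LevelMonoid

/-- The submonoid of all naturals which are at least `k r * m + r`, where `r` is their residue
modulo `m`. -/
def levelMonoid (m : ℕ) (k : ℕ → ℕ) (h0 : k 0 = 0) (hk : ∀ r, r ≠ 0 → 2 ≤ k r ∧ k r ≤ 4) :
    AddSubmonoid ℕ where
  carrier := {n | k (n % m) ≤ n / m}
  zero_mem' := by simp [h0]
  add_mem' := by
    intro a b (ha : k (a % m) ≤ a / m) (hb : k (b % m) ≤ b / m)
    change k ((a + b) % m) ≤ (a + b) / m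
    have h1 : a / m + b / m ≤ (a + b) / m := Nat.div_add_div_le_add_div
    by_cases har : a % m = 0
    · rw [Nat.add_mod, har, zero_add, Nat.mod_mod]
      omega
    by_cases hbr : b % m = 0
    · rw [Nat.add_mod, hbr, add_zero, Nat.mod_mod]
      omega
    have h2 := hk _ har
    have h3 := hk _ hbr
    by_cases hr : (a + b) % m = 0
    · rw [hr, h0]
      exact Nat.zero_le _
    · have := hk _ hr
      omega

variable {m : ℕ} {k : ℕ → ℕ} {h0 : k 0 = 0} {hk : ∀ r, r ≠ 0 → 2 ≤ k r ∧ k r ≤ 4}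

lemma mem_levelMonoid {n : ℕ} : n ∈ levelMonoid m k h0 hk ↔ k (n % m) ≤ n / m := Iff.rfl

lemma mul_add_mem_levelMonoid {q r : ℕ} (hr : r < m) :
    q * m + r ∈ levelMonoid m k h0 hk ↔ k r ≤ q := by
  rw [mem_levelMonoid, mul_comm, Nat.mul_add_mod, Nat.mod_eq_of_lt hr,
    Nat.mul_add_div (by omega), Nat.div_eq_of_lt hr, add_zero]

lemma mem_levelMonoid_of_le (hm : 0 < m) {n : ℕ} (h : 4 * m ≤ n) :
    n ∈ levelMonoid m k h0 hk := by
  have h4 : 4 ≤ n / m := (Nat.le_div_iff_mul_le hm).2 h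
  rw [mem_levelMonoid]
  by_cases hr : n % m = 0
  · rw [hr, h0]
    exact Nat.zero_le _
  · exact (hk _ hr).2.trans h4

lemma isNumericalMonoid_levelMonoid (hm : 0 < m) : IsNumericalMonoid (levelMonoid m k h0 hk) := by
  refine (Set.finite_Iio (4 * m)).subset fun n hn => ?_
  by_contra! h
  exact hn (mem_levelMonoid_of_le hm (not_lt.1 h))

lemma self_mem_levelMonoid : m ∈ levelMonoid m k h0 hk := by
  rw [mem_levelMonoid]
  simp [h0]

lemma le_of_mem_levelMonoid {n : ℕ} (hn : n ∈ levelMonoid m k h0 hk) (hn0 : n ≠ 0) : m ≤ n := by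
  by_contra! h
  rw [mem_levelMonoid, Nat.mod_eq_of_lt h, Nat.div_eq_of_lt h] at hn
  have := hk n hn0
  omega

lemma mult_levelMonoid (hm : 0 < m) : mult (levelMonoid m k h0 hk) = m :=
  IsLeast.csInf_eq ⟨⟨self_mem_levelMonoid, hm.ne'⟩, fun _ h => le_of_mem_levelMonoid h.1 h.2⟩

lemma minGens_levelMonoid (hm : 0 < m)
    (hsum : ∀ r < m, k r = 4 → ∃ a b, k a = 2 ∧ k b = 2 ∧ r = a + b) :
    minGens (levelMonoid m k h0 hk) = (fun r => max (k r) 1 * m + r) '' {r | r < m ∧ k r ≠ 4} := by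
  ext g
  constructor
  · rintro ⟨hg, hg0, hgen⟩
    have hdm := Nat.div_add_mod' g m
    have hr := Nat.mod_lt g hm
    have hnot : ∀ q, g / m = q + 1 → k (g % m) ≤ q → q = 0 ∧ g % m = 0 := by
      intro q hq hkq
      by_contra hcon
      refine hgen m (self_mem_levelMonoid) (q * m + g % m)
        ((mul_add_mem_levelMonoid hr).2 hkq) hm.ne' ?_ ?_
      · intro h
        rw [Nat.add_eq_zero_iff, Nat.mul_eq_zero] at h
        exact hcon ⟨h.1.resolve_right hm.ne', h.2⟩
      · rw [hq] at hdm
        linarith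
    rw [mem_levelMonoid] at hg
    have hq : g / m = max (k (g % m)) 1 := by
      rcases Nat.eq_zero_or_pos (g / m) with hq | hq
      · rw [hq] at hg
        have hr0 : g % m = 0 := by
          by_contra h
          have := hk _ h
          omega
        rw [hq, hr0] at hdm
        omega
      · by_contra hne
        have := hnot (g / m - 1) (by omega) (by omega)
        rw [this.2, h0] at hne
        omega
    refine ⟨g % m, ⟨hr, fun h4 => ?_⟩, ?_⟩
    · obtain ⟨a, b, ha, hb, hab⟩ := hsum _ hr h4
      refine hgen (2 * m + a) ((mul_add_mem_levelMonoid (by omega)).2 ha.le) (2 * m + b)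
        ((mul_add_mem_levelMonoid (by omega)).2 hb.le) (by omega) (by omega) ?_
      rw [hq, h4, show max 4 1 = 4 from rfl] at hdm
      omega
    · simp only
      rw [← hq, hdm]
  · rintro ⟨r, ⟨hr, h4⟩, rfl⟩
    simp only
    refine ⟨(mul_add_mem_levelMonoid hr).2 (le_max_left _ _), ?_, ?_⟩
    · have := Nat.mul_le_mul_right m (le_max_right (k r) 1)
      omega
    · intro a ha b hb ha0 hb0 hab
      have ham := le_of_mem_levelMonoid ha ha0
      have hbm := le_of_mem_levelMonoid hb hb0
      rcases eq_or_ne r 0 with rfl | hr0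
      · rw [h0] at hab
        simp at hab
        omega
      have hkr := hk r hr0
      rw [max_eq_left (by omega)] at hab
      have key : ∀ a b : ℕ, m ≤ a → k (b % m) ≤ b / m → a % m = 0 → k r * m + r ≠ a + b := by
        intro a b ham hb har hab
        have h1 : (a + b) % m = r := by
          rw [← hab, mul_comm, Nat.mul_add_mod, Nat.mod_eq_of_lt hr]
        rw [Nat.add_mod, har, zero_add, Nat.mod_mod] at h1
        rw [h1] at hb
        have h2 := Nat.div_add_mod' b m
        have h3 := Nat.mul_le_mul_right m hb
        omega
      by_cases har : a % m = 0
      · exact key a b ham hb har hab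
      by_cases hbr : b % m = 0
      · exact key b a hbm ha hbr (hab.trans (add_comm a b))
      have h2 : ∀ a, k (a % m) ≤ a / m → a % m ≠ 0 → 2 * m ≤ a := by
        intro a ha har
        have h2 := Nat.div_add_mod' a m
        have h3 := Nat.mul_le_mul_right m ((hk _ har).1.trans ha)
        omega
      have h3 := h2 a ha har
      have h4 := h2 b hb hbr
      have h5 := Nat.mul_le_mul_right m (show k r ≤ 3 by omega)
      omega

lemma edim_levelMonoid (hm : 0 < m)
    (hsum : ∀ r < m, k r = 4 → ∃ a b, k a = 2 ∧ k b = 2 ∧ r = a + b) :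
    edim (levelMonoid m k h0 hk) + ((Finset.range m).filter fun r => k r = 4).card = m := by
  have hinj : Set.InjOn (fun r => max (k r) 1 * m + r) {r | r < m ∧ k r ≠ 4} := by
    intro a ha b hb hab
    have := congrArg (· % m) hab
    simpa [mul_comm _ m, Nat.mul_add_mod, Nat.mod_eq_of_lt ha.1, Nat.mod_eq_of_lt hb.1] using this
  rw [edim, minGens_levelMonoid hm hsum, hinj.ncard_image]
  have hset : {r | r < m ∧ k r ≠ 4} =
      (((Finset.range m).filter fun r => ¬ k r = 4 : Finset ℕ) : Set ℕ) := by
    ext r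
    simp
  rw [hset, Set.ncard_coe_finset, add_comm, Finset.card_filter_add_card_filter_not,
    Finset.card_range]

/-- The minimal generators of a level monoid other than `m` itself. -/
lemma exists_of_mem_minGens_levelMonoid (hm : 0 < m)
    (hsum : ∀ r < m, k r = 4 → ∃ a b, k a = 2 ∧ k b = 2 ∧ r = a + b) {g : ℕ}
    (hg : g ∈ minGens (levelMonoid m k h0 hk)) (hgm : g ≠ m) :
    ∃ r, 0 < r ∧ r < m ∧ (k r = 2 ∧ g = 2 * m + r ∨ g = 3 * m + r) := by
  rw [minGens_levelMonoid hm hsum] at hg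
  obtain ⟨r, ⟨hr, h4⟩, rfl⟩ := hg
  rcases Nat.eq_zero_or_pos r with rfl | hr0
  · simp [h0] at hgm
  refine ⟨r, hr0, hr, ?_⟩
  have h := hk r hr0.ne'
  simp only
  rw [max_eq_left (by omega)]
  rcases (show k r = 2 ∨ k r = 3 by omega) with h | h
  · exact Or.inl ⟨h, by rw [h]⟩
  · exact Or.inr (by rw [h])

end LevelMonoid

section FourPow

lemma eq_of_add_four_pow_eq {a b k l : ℕ} (ha : a ≤ 2 * 4 ^ k) (hb : b ≤ 2 * 4 ^ l)
    (h : a + 4 ^ k = b + 4 ^ l) : k = l ∧ a = b := by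
  have key : ∀ {a b k l : ℕ}, a ≤ 2 * 4 ^ k → a + 4 ^ k = b + 4 ^ l → l ≤ k := by
    intro a b k l ha h
    by_contra! hlt
    have h1 : 4 ^ (k + 1) ≤ 4 ^ l := Nat.pow_le_pow_right (by norm_num) hlt
    have h2 : 0 < 4 ^ k := Nat.pow_pos (by norm_num)
    rw [pow_succ] at h1
    omega
  obtain rfl : k = l := le_antisymm (key hb h.symm) (key ha h)
  exact ⟨rfl, by omega⟩

lemma four_pow_le {j k : ℕ} (h : j ≤ k) : 4 ^ j ≤ 4 ^ k := Nat.pow_le_pow_right (by norm_num) h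

lemma eq_of_four_pow_add_eq {i j k l : ℕ} (hij : i ≤ j) (hkl : k ≤ l)
    (h : 4 ^ i + 4 ^ j = 4 ^ k + 4 ^ l) : i = k ∧ j = l := by
  have h1 := four_pow_le hij
  have h2 := four_pow_le hkl
  obtain ⟨h3, h4⟩ := eq_of_add_four_pow_eq (by omega) (by omega) h
  exact ⟨Nat.pow_right_injective (show 2 ≤ 4 by norm_num) h4, h3⟩

lemma four_pow_add_ne_four_pow (i j k : ℕ) : 4 ^ i + 4 ^ j ≠ 4 ^ k := by
  wlog hij : i ≤ j generalizing i j
  · rw [add_comm]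
    exact this j i (le_of_not_ge hij)
  intro h
  have h1 := four_pow_le hij
  have h2 : 0 < 4 ^ i := Nat.pow_pos (by norm_num)
  have := (eq_of_add_four_pow_eq (b := 0) (by omega) (by omega) (h.trans (zero_add _).symm)).2
  omega

lemma eq_of_four_pow_add_add_eq {i j k i' j' k' : ℕ} (hij : i ≤ j) (hjk : j ≤ k) (hij' : i' ≤ j')
    (hjk' : j' ≤ k') (h : 4 ^ i + 4 ^ j + 4 ^ k = 4 ^ i' + 4 ^ j' + 4 ^ k') :
    i = i' ∧ j = j' ∧ k = k' := by
  have h1 := four_pow_le hij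
  have h2 := four_pow_le hij'
  have h3 := four_pow_le hjk
  have h4 := four_pow_le hjk'
  obtain ⟨h5, h6⟩ := eq_of_add_four_pow_eq (by omega) (by omega) h
  obtain ⟨h7, h8⟩ := eq_of_four_pow_add_eq hij hij' h6
  exact ⟨h7, h8, h5⟩

end FourPow

section EarlyPairs

/-- The pair `j ≤ l` is among the first `s` pairs in the colexicographic order. -/
def IsEarly (s j l : ℕ) : Prop := j ≤ l ∧ (l + 1).choose 2 + j < s

lemma IsEarly.lt {s j l : ℕ} (h : IsEarly s j l) : l < s := by
  have h1 := h.2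
  rw [choose_two_succ] at h1
  omega

lemma IsEarly.of_le {s i j k l : ℕ} (h : IsEarly s j l) (hij : i ≤ j) (hik : i ≤ k) (hkl : k ≤ l) :
    IsEarly s i k := by
  refine ⟨hik, lt_of_le_of_lt ?_ h.2⟩
  exact Nat.add_le_add (Nat.choose_le_choose 2 (by omega)) hij

lemma eq_of_choose_two_add_eq {j k j' k' : ℕ} (hj : j ≤ k) (hj' : j' ≤ k')
    (h : (k + 1).choose 2 + j = (k' + 1).choose 2 + j') : j = j' ∧ k = k' := by
  have key : ∀ {j k j' k' : ℕ}, j ≤ k → (k + 1).choose 2 + j = (k' + 1).choose 2 + j' → k' ≤ k := by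
    intro j k j' k' hj h
    by_contra! hlt
    have h1 : (k + 1 + 1).choose 2 ≤ (k' + 1).choose 2 := Nat.choose_le_choose 2 (by omega)
    rw [choose_two_succ (k + 1)] at h1
    omega
  obtain rfl : k = k' := le_antisymm (key hj' h.symm) (key hj h)
  exact ⟨by omega, rfl⟩

/-- The lower entry of the `n`-th pair in the colexicographic order. -/
noncomputable def pairFst (n : ℕ) : ℕ := (exists_eq_choose_two_add n).choose

/-- The upper entry of the `n`-th pair in the colexicographic order. -/
noncomputable def pairSnd (n : ℕ) : ℕ := (exists_eq_choose_two_add n).choose_spec.choose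

lemma eq_choose_pairSnd_add_pairFst (n : ℕ) : n = (pairSnd n + 1).choose 2 + pairFst n :=
  (exists_eq_choose_two_add n).choose_spec.choose_spec.1

lemma pairFst_le_pairSnd (n : ℕ) : pairFst n ≤ pairSnd n :=
  (exists_eq_choose_two_add n).choose_spec.choose_spec.2

lemma isEarly_iff {s j l : ℕ} : IsEarly s j l ↔ ∃ n < s, pairFst n = j ∧ pairSnd n = l := by
  constructor
  · rintro ⟨hjl, h⟩
    exact ⟨_, h, eq_of_choose_two_add_eq (pairFst_le_pairSnd _) hjl
      (eq_choose_pairSnd_add_pairFst _).symm⟩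
  · rintro ⟨n, hn, rfl, rfl⟩
    exact ⟨pairFst_le_pairSnd n, by rwa [← eq_choose_pairSnd_add_pairFst]⟩

lemma isEarly_pair {s n : ℕ} (h : n < s) : IsEarly s (pairFst n) (pairSnd n) :=
  isEarly_iff.2 ⟨n, h, rfl, rfl⟩

lemma eq_of_pair_eq {n n' : ℕ} (h : pairFst n = pairFst n') (h' : pairSnd n = pairSnd n') :
    n = n' := by
  rw [eq_choose_pairSnd_add_pairFst n, eq_choose_pairSnd_add_pairFst n', h, h']

lemma sum_pairFst_add_one (s : ℕ) : ∑ n ∈ Finset.range s, (pairFst n + 1) = macUpper 2 s := by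
  induction s with
  | zero => simp [macUpper_two_zero]
  | succ s ih =>
    rw [Finset.sum_range_succ, ih]
    have h := macUpper_two_succ (pairFst_le_pairSnd s)
    rw [← eq_choose_pairSnd_add_pairFst] at h
    exact h.symm

open Classical in
/-- The levels of the residues: two at the first `s` powers of four, four at the sums of early pairs
of such powers, and three elsewhere. -/
noncomputable def levelFun (s r : ℕ) : ℕ :=
  if r = 0 then 0
  else if ∃ i < s, r = 4 ^ i then 2
  else if ∃ j l, IsEarly s j l ∧ r = 4 ^ j + 4 ^ l then 4
  else 3

lemma levelFun_zero (s : ℕ) : levelFun s 0 = 0 := if_pos rfl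

lemma levelFun_bounds (s r : ℕ) (hr : r ≠ 0) : 2 ≤ levelFun s r ∧ levelFun s r ≤ 4 := by
  rw [levelFun, if_neg hr]
  split_ifs <;> norm_num

lemma levelFun_eq_two_iff {s r : ℕ} : levelFun s r = 2 ↔ ∃ i < s, r = 4 ^ i := by
  rw [levelFun]
  split_ifs with h1 h2 h3
  · subst h1
    simp [eq_comm (a := 0)]
  all_goals simp [h2]

lemma levelFun_eq_four_iff {s r : ℕ} :
    levelFun s r = 4 ↔ ∃ j l, IsEarly s j l ∧ r = 4 ^ j + 4 ^ l := by
  rw [levelFun]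
  split_ifs with h1 h2 h3
  · subst h1
    simp [eq_comm (a := 0)]
  · obtain ⟨i, -, rfl⟩ := h2
    simp [(four_pow_add_ne_four_pow _ _ _).symm]
  all_goals simp [h3]

lemma exists_levelFun_eq_two {s r : ℕ} (h : levelFun s r = 4) :
    ∃ a b, levelFun s a = 2 ∧ levelFun s b = 2 ∧ r = a + b := by
  obtain ⟨j, l, he, rfl⟩ := levelFun_eq_four_iff.1 h
  have := he.lt
  have := he.1
  exact ⟨_, _, levelFun_eq_two_iff.2 ⟨j, by omega, rfl⟩,
    levelFun_eq_two_iff.2 ⟨l, by omega, rfl⟩, rfl⟩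

lemma four_pow_add_lt {m s i j : ℕ} (hm : 2 * 4 ^ s < m) (hi : i < s) (hj : j < s) :
    4 ^ i + 4 ^ j < m := by
  have := four_pow_le hi.le
  have := four_pow_le hj.le
  omega

lemma card_filter_levelFun_eq_four {m s : ℕ} (hm : 2 * 4 ^ s < m) :
    ((Finset.range m).filter fun r => levelFun s r = 4).card = s := by
  have h : (Finset.range m).filter (fun r => levelFun s r = 4) =
      (Finset.range s).image fun n => 4 ^ pairFst n + 4 ^ pairSnd n := by
    ext r
    simp only [Finset.mem_filter, Finset.mem_range, Finset.mem_image, levelFun_eq_four_iff,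
      isEarly_iff]
    constructor
    · rintro ⟨-, _, _, ⟨n, hn, rfl, rfl⟩, rfl⟩
      exact ⟨n, hn, rfl⟩
    · rintro ⟨n, hn, rfl⟩
      have he := isEarly_pair hn
      exact ⟨four_pow_add_lt hm (he.1.trans_lt he.lt) he.lt, _, _, ⟨n, hn, rfl, rfl⟩, rfl⟩
  rw [h, Finset.card_image_of_injective, Finset.card_range]
  intro n n' hn
  have := eq_of_four_pow_add_eq (pairFst_le_pairSnd n) (pairFst_le_pairSnd n') hn
  exact eq_of_pair_eq this.1 this.2

end EarlyPairs

section EarlyMonoid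

/-- A monoid of multiplicity `m` and embedding dimension `m - s` with many minimal relations. -/
noncomputable abbrev earlyMonoid (m s : ℕ) : AddSubmonoid ℕ :=
  levelMonoid m (levelFun s) (levelFun_zero s) (levelFun_bounds s)

variable {m s : ℕ}

lemma edim_earlyMonoid (hm : 2 * 4 ^ s < m) : edim (earlyMonoid m s) + s = m := by
  have h := edim_levelMonoid (h0 := levelFun_zero s) (hk := levelFun_bounds s)
    (show 0 < m by omega) fun r _ => exists_levelFun_eq_two
  rwa [card_filter_levelFun_eq_four hm] at h

/-- The minimal generators of `earlyMonoid m s` are `m`, the `2 * m + 4 ^ i` for `i < s`, and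
numbers between `3 * m` and `4 * m`. -/
lemma minGens_earlyMonoid_cases (hm : 0 < m) (g : minGens (earlyMonoid m s)) :
    (g : ℕ) = m ∨ (2 * m ≤ (g : ℕ) ∧ ∃ i < s, (g : ℕ) = 2 * m + 4 ^ i) ∨
      3 * m ≤ (g : ℕ) ∧ (g : ℕ) < 4 * m := by
  by_cases hgm : (g : ℕ) = m
  · exact Or.inl hgm
  obtain ⟨r, -, hr, ⟨h, hg⟩ | hg⟩ :=
    exists_of_mem_minGens_levelMonoid hm (fun r _ => exists_levelFun_eq_two) g.2 hgm
  · obtain ⟨i, hi, rfl⟩ := levelFun_eq_two_iff.1 h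
    exact Or.inr (Or.inl ⟨by rw [hg]; exact Nat.le_add_right _ _, i, hi, hg⟩)
  · exact Or.inr (Or.inr (by omega))

lemma exists_minGens_earlyMonoid (hm : 2 * 4 ^ s < m) :
    ∃ x : ℕ → minGens (earlyMonoid m s), ∀ i < s, (x i : ℕ) = 2 * m + 4 ^ i := by
  have hgen := minGens_levelMonoid (h0 := levelFun_zero s) (hk := levelFun_bounds s)
    (show 0 < m by omega) fun r _ => exists_levelFun_eq_two
  have hmem : ∀ r < m, levelFun s r ≠ 4 →
      max (levelFun s r) 1 * m + r ∈ minGens (earlyMonoid m s) := by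
    intro r hr h4
    rw [hgen]
    exact ⟨r, ⟨hr, h4⟩, rfl⟩
  have h : ∀ i, ∃ x : minGens (earlyMonoid m s), i < s → (x : ℕ) = 2 * m + 4 ^ i := by
    intro i
    by_cases hi : i < s
    · have h2 : levelFun s (4 ^ i) = 2 := levelFun_eq_two_iff.2 ⟨i, hi, rfl⟩
      have := four_pow_le hi.le
      refine ⟨⟨_, hmem (4 ^ i) (by omega) (by omega)⟩, fun _ => ?_⟩
      simp [h2]
    · exact ⟨⟨_, hmem 0 (by omega) (by simp [levelFun_zero])⟩, fun h => absurd h hi⟩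
  choose x hx using h
  exact ⟨x, hx⟩

variable {x : ℕ → minGens (earlyMonoid m s)}

/-- The sum of two small generators attached to an early pair has no other factorization. -/
lemma eq_of_factorizationHom_eq_early (hm : 2 * 4 ^ s < m) (hx : ∀ i < s, (x i : ℕ) = 2 * m + 4 ^ i)
    {j l : ℕ} (he : IsEarly s j l) {v : minGens (earlyMonoid m s) →₀ ℕ}
    (hv : factorizationHom _ v = 4 * m + (4 ^ j + 4 ^ l)) :
    v = Finsupp.single (x j) 1 + Finsupp.single (x l) 1 := by
  have hls := he.lt
  have hjl := he.1
  have hlt : 4 ^ j + 4 ^ l < m := four_pow_add_lt hm (by omega) hls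
  have hnonneg := Nat.zero_le (4 ^ j + 4 ^ l)
  have hne : ∀ u : minGens (earlyMonoid m s) →₀ ℕ,
      factorizationHom _ u + m ≠ 4 * m + (4 ^ j + 4 ^ l) := by
    intro u hu
    have hmem := factorizationHom_mem u
    rw [show factorizationHom _ u = 3 * m + (4 ^ j + 4 ^ l) by omega,
      mul_add_mem_levelMonoid hlt, levelFun_eq_four_iff.2 ⟨j, l, he, rfl⟩] at hmem
    omega
  have hpos : ∀ u : minGens (earlyMonoid m s) →₀ ℕ, factorizationHom _ u ≠ 0 →
      ∃ w g, u = w + Finsupp.single g 1 := by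
    intro u hu
    obtain ⟨g, hg⟩ : ∃ g, u g ≠ 0 := by
      by_contra! h
      exact hu (by rw [show u = 0 from Finsupp.ext h, map_zero])
    obtain ⟨w, hw⟩ := exists_eq_add_single hg
    exact ⟨w, g, hw⟩
  have hge : ∀ g : minGens (earlyMonoid m s), (g : ℕ) ≠ m → 2 * m ≤ g ∧ (g : ℕ) < 4 * m := by
    intro g hgm
    rcases minGens_earlyMonoid_cases (by omega) g with hg | hg | hg
    · exact absurd hg hgm
    · obtain ⟨hg, i, hi, hgi⟩ := hg
      have := four_pow_le hi.le
      omega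
    · omega
  have hsmall : ∀ g : minGens (earlyMonoid m s), (g : ℕ) ≠ m → (g : ℕ) < 3 * m →
      ∃ i < s, (g : ℕ) = 2 * m + 4 ^ i := by
    intro g hgm hlt
    rcases minGens_earlyMonoid_cases (by omega) g with hg | hg | hg
    · exact absurd hg hgm
    · exact hg.2
    · omega
  obtain ⟨u, g, rfl⟩ := hpos v (by omega)
  rw [factorizationHom_add_single] at hv
  have hgm : (g : ℕ) ≠ m := fun h => hne u (by omega)
  have hg := hge g hgm
  obtain ⟨w, h, rfl⟩ := hpos u (by omega)
  have hhm : (h : ℕ) ≠ m := fun h' => hne (w + Finsupp.single g 1) (by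
    rw [factorizationHom_add_single] at hv ⊢
    omega)
  have hh := hge h hhm
  rw [factorizationHom_add_single] at hv
  have hw : w = 0 := by
    by_contra hw
    have h1 : factorizationHom _ w ≠ 0 := fun h => hw (eq_zero_of_factorizationHom_eq_zero h)
    have := le_of_mem_levelMonoid (factorizationHom_mem w) h1
    omega
  subst hw
  rw [map_zero, zero_add] at hv
  obtain ⟨a, ha, hga⟩ := hsmall g hgm (by omega)
  obtain ⟨b, hb, hhb⟩ := hsmall h hhm (by omega)
  obtain rfl : g = x a := Subtype.ext (hga.trans (hx a ha).symm)
  obtain rfl : h = x b := Subtype.ext (hhb.trans (hx b hb).symm)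
  rw [zero_add]
  rcases le_total a b with hab | hab
  · obtain ⟨rfl, rfl⟩ := eq_of_four_pow_add_eq hab hjl (by omega)
    exact add_comm _ _
  · obtain ⟨rfl, rfl⟩ := eq_of_four_pow_add_eq hab hjl (by omega)
    rfl

/-- If `n - m` lies in the monoid, then `n` has a factorization involving `m`. -/
lemma exists_factorizationHom_add_mult {g₀ : minGens (earlyMonoid m s)} (hg₀ : (g₀ : ℕ) = m) {n : ℕ}
    (hn : n ∈ earlyMonoid m s) : ∃ v, factorizationHom _ v = n + m ∧ v g₀ ≠ 0 := by
  obtain ⟨v, hv⟩ := exists_factorizationHom_eq hn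
  exact ⟨v + Finsupp.single g₀ 1, by rw [factorizationHom_add_single, hv, hg₀], by simp⟩

open Finset in
lemma le_rho_earlyMonoid {e : ℕ} (hm : 2 * 4 ^ s < m) (he : m = e + 1 + s) :
    (e + 1).choose 2 + macUpper 2 s ≤ rho (earlyMonoid m s) + s := by
  classical
  have hm0 : 0 < m := by omega
  have hedim : edim (earlyMonoid m s) = e + 1 := by
    have := edim_earlyMonoid hm
    omega
  have hmult : mult (earlyMonoid m s) = m := mult_levelMonoid hm0
  have hfin : (minGens (earlyMonoid m s)).Finite :=
    Set.finite_of_ncard_ne_zero (by rw [← edim]; omega)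
  have : Finite (minGens (earlyMonoid m s)) := hfin
  have : Fintype (minGens (earlyMonoid m s)) := Fintype.ofFinite _
  have hne : (minGens (earlyMonoid m s)).Nonempty :=
    Set.nonempty_of_ncard_ne_zero (by rw [← edim]; omega)
  obtain ⟨g₀, hg₀⟩ : ∃ g₀ : minGens (earlyMonoid m s), (g₀ : ℕ) = m :=
    ⟨⟨_, mult_mem_minGens hne⟩, hmult⟩
  obtain ⟨x, hx⟩ := exists_minGens_earlyMonoid hm
  have hxg : ∀ i < s, x i ≠ g₀ := by
    intro i hi h
    have h2 := hx i hi
    have := Nat.zero_le (4 ^ i)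
    rw [h] at h2
    omega
  obtain ⟨P, hPcard, hP⟩ := exists_finset_degree_two (univ.erase g₀)
  have hcard : #(univ.erase g₀) = e := by
    rw [card_erase_of_mem (mem_univ _), card_univ, ← Nat.card_eq_fintype_card, Nat.card_coe_set_eq,
      ← edim, hedim, Nat.add_sub_cancel]
  rw [hcard] at hPcard
  let E : Finset (minGens (earlyMonoid m s) →₀ ℕ) := (range s).image fun n =>
    Finsupp.single (x (pairFst n)) 1 + Finsupp.single (x (pairSnd n)) 1
  have hEcard : #E ≤ s := card_image_le.trans (card_range s).le
  let T : Finset (Σ _ : ℕ, ℕ) := (range s).sigma fun n => range (pairFst n + 1)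
  let t : (Σ _ : ℕ, ℕ) → (minGens (earlyMonoid m s) →₀ ℕ) := fun p => Finsupp.single (x p.2) 1 +
    Finsupp.single (x (pairFst p.1)) 1 + Finsupp.single (x (pairSnd p.1)) 1
  have hT : ∀ p ∈ T, p.1 < s ∧ p.2 ≤ pairFst p.1 := by
    intro p hp
    simpa [T, Nat.lt_succ_iff] using hp
  have htval : ∀ p ∈ T, factorizationHom _ (t p) =
      6 * m + (4 ^ p.2 + 4 ^ pairFst p.1 + 4 ^ pairSnd p.1) := by
    intro p hp
    obtain ⟨h1, h2⟩ := hT p hp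
    have h3 := (isEarly_pair h1).1
    have h4 := (isEarly_pair h1).lt
    simp only [t, factorizationHom_add_single, factorizationHom_single]
    rw [hx _ (by omega), hx _ (by omega), hx _ h4]
    omega
  have htinj : Set.InjOn t T := by
    rintro ⟨n, i⟩ hp ⟨n', i'⟩ hp' h
    have h1 := htval _ hp
    rw [h, htval _ hp'] at h1
    obtain ⟨h2, h3, h4⟩ := eq_of_four_pow_add_add_eq (hT _ hp').2 (pairFst_le_pairSnd _)
      (hT _ hp).2 (pairFst_le_pairSnd _) (Nat.add_left_cancel h1)
    obtain rfl := eq_of_pair_eq h3 h4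
    rw [show i = i' from h2.symm]
  have hTcard : #(T.image t) = macUpper 2 s := by
    rw [card_image_of_injOn htinj, card_sigma, ← sum_pairFst_add_one]
    simp
  have hdeg : ∀ c ∈ T.image t, c.degree = 3 := by
    intro c hc
    obtain ⟨p, -, rfl⟩ := mem_image.1 hc
    simp [t, Finsupp.degree_single]
  have hdisj : Disjoint (P \ E) (T.image t) := by
    rw [disjoint_left]
    intro c hc hc'
    have h1 := ((hP c).1 (mem_sdiff.1 hc).1).1
    have h2 := hdeg c hc'
    omega
  have hzero : ∀ c ∈ (P \ E) ∪ T.image t, c g₀ = 0 := by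
    intro c hc
    rcases mem_union.1 hc with hc | hc
    · by_contra h
      exact notMem_erase _ _ (((hP c).1 (mem_sdiff.1 hc).1).2 g₀ h)
    · obtain ⟨p, hp, rfl⟩ := mem_image.1 hc
      obtain ⟨h1, h2⟩ := hT p hp
      have h3 := (isEarly_pair h1).1
      have h4 := (isEarly_pair h1).lt
      simp [t, hxg _ h4, hxg (pairFst p.1) (by omega),
        hxg p.2 (by omega)]
  have hC : #((P \ E) ∪ T.image t) ≤ rho (earlyMonoid m s) := by
    refine card_le_rho (rho_add_le hedim (hmult.trans he)).1 _ ?_ ?_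
    · intro c hc u y hcu v hv
      rcases mem_union.1 hc with hc | hc
      · have h1 := ((hP c).1 (mem_sdiff.1 hc).1).1
        rw [hcu, degree_add_single] at h1
        obtain ⟨z, hz⟩ := exists_apply_ne_zero_of_degree_pos (w := u) (by omega)
        obtain rfl := eq_single_of_degree_eq_one (w := u) (by omega) hz
        refine eq_single_of_factorizationHom_eq (hv.trans ?_)
        rw [factorizationHom_single, mul_one]
      · obtain ⟨p, hp, rfl⟩ := mem_image.1 hc
        obtain ⟨h1, h2⟩ := hT p hp
        have h3 := isEarly_pair h1
        have huniq : ∀ {j l}, IsEarly s j l →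
            u = Finsupp.single (x j) 1 + Finsupp.single (x l) 1 → v = u := by
          intro j l hjl hu
          refine (eq_of_factorizationHom_eq_early hm hx hjl (hv.trans ?_)).trans hu.symm
          have h4 := hjl.1
          have h5 := hjl.lt
          rw [hu, factorizationHom_add_single, factorizationHom_single, hx _ h5, hx _ (by omega)]
          omega
        have hy : y = x p.2 ∨ y = x (pairFst p.1) ∨ y = x (pairSnd p.1) := by
          by_contra! hy
          have h4 := DFunLike.congr_fun hcu y
          simp [t, hy.1.symm, hy.2.1.symm, hy.2.2.symm] at h4
        rcases hy with rfl | rfl | rfl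
        · refine huniq h3 (add_right_cancel (hcu.symm.trans ?_))
          simp only [t]
          abel
        · refine huniq (h3.of_le h2 (h2.trans h3.1) le_rfl) (add_right_cancel (hcu.symm.trans ?_))
          simp only [t]
          abel
        · exact huniq (h3.of_le h2 h2 h3.1) (add_right_cancel (hcu.symm.trans rfl))
    · intro c hc
      suffices h : ∃ n ∈ earlyMonoid m s, factorizationHom _ c = n + m by
        obtain ⟨n, hn, hcn⟩ := h
        obtain ⟨v, hv, hvg⟩ := exists_factorizationHom_add_mult hg₀ hn
        exact ⟨v, hv.trans hcn.symm, fun h => hvg (hzero v h)⟩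
      suffices h : 5 * m ≤ factorizationHom _ c ∨
          ∃ r < m, factorizationHom _ c = 4 * m + r ∧ levelFun s r ≠ 4 by
        rcases h with h | ⟨r, hr, h, h4⟩
        · exact ⟨factorizationHom _ c - m, mem_levelMonoid_of_le hm0 (by omega), by omega⟩
        · refine ⟨3 * m + r, (mul_add_mem_levelMonoid hr).2 ?_, by omega⟩
          rcases eq_or_ne r 0 with rfl | hr0
          · rw [levelFun_zero]
            omega
          · have := levelFun_bounds s r hr0
            omega
      rcases mem_union.1 hc with hc | hc
      · obtain ⟨hcP, hcE⟩ := mem_sdiff.1 hc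
        obtain ⟨h1, h2⟩ := (hP c).1 hcP
        obtain ⟨g, hg⟩ := exists_apply_ne_zero_of_degree_pos (w := c) (by omega)
        obtain ⟨u, rfl⟩ := exists_eq_add_single hg
        rw [degree_add_single] at h1
        obtain ⟨h, hh⟩ := exists_apply_ne_zero_of_degree_pos (w := u) (by omega)
        obtain rfl := eq_single_of_degree_eq_one (w := u) (by omega) hh
        have hgm : ∀ g ∈ univ.erase g₀, (g : ℕ) ≠ m := fun g hg h =>
          (mem_erase.1 hg).1 (Subtype.ext (h.trans hg₀.symm))
        have hgm' := hgm g (h2 g hg)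
        have hhm := hgm h (h2 h (by simp))
        rw [factorizationHom_add_single, factorizationHom_single, mul_one]
        rcases minGens_earlyMonoid_cases hm0 g with hg | ⟨hg, b, hb, hgb⟩ | hg
        · exact absurd hg hgm'
        · rcases minGens_earlyMonoid_cases hm0 h with hh | ⟨hh, a, ha, hha⟩ | hh
          · exact absurd hh hhm
          · refine Or.inr ⟨4 ^ a + 4 ^ b, four_pow_add_lt hm ha hb, by omega, fun h4 => hcE ?_⟩
            obtain ⟨j, l, hjl, h5⟩ := levelFun_eq_four_iff.1 h4
            have h6 := eq_of_factorizationHom_eq_early hm hx hjl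
              (v := Finsupp.single h 1 + Finsupp.single g 1) (by
                rw [factorizationHom_add_single, factorizationHom_single]
                omega)
            obtain ⟨n, hn, rfl, rfl⟩ := isEarly_iff.1 hjl
            exact mem_image.2 ⟨n, mem_range.2 hn, h6.symm⟩
          · left
            omega
        · rcases minGens_earlyMonoid_cases hm0 h with hh | ⟨hh, a, ha, hha⟩ | hh
          · exact absurd hh hhm
          · left
            omega
          · left
            omega
      · obtain ⟨p, hp, rfl⟩ := mem_image.1 hc
        rw [htval p hp]
        exact Or.inl (le_add_right (Nat.mul_le_mul_right m (by norm_num)))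
  rw [card_union_of_disjoint hdisj, hTcard] at hC
  have := le_card_sdiff E P
  omega

end EarlyMonoid

/-- For each fixed value of m - e = δ, we have 𝒭(e,m) = 𝒞(e,m) for all m ≫ 0. -/
theorem rho_max_eq_C_of_fixed_diff :
    ∀ δ : ℕ, 1 ≤ δ →
    ∃ M : ℕ, ∀ m : ℕ, M ≤ m →
      (∀ Γ : AddSubmonoid ℕ, IsNumericalMonoid Γ →
        edim Γ = (m - δ) + 1 → mult Γ = m → rho Γ ≤ mathcalC (m - δ) m) ∧
      (∃ Γ : AddSubmonoid ℕ, IsNumericalMonoid Γ ∧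
        edim Γ = (m - δ) + 1 ∧ mult Γ = m ∧ rho Γ = mathcalC (m - δ) m) := by
  intro δ hδ
  obtain ⟨s, rfl⟩ : ∃ s, δ = s + 1 := ⟨δ - 1, by omega⟩
  refine ⟨2 * 4 ^ s + 2 * s + 3, fun m hM => ?_⟩
  have h4 : 0 < 4 ^ s := Nat.pow_pos (by norm_num)
  obtain ⟨e, rfl⟩ : ∃ e, m = e + 1 + s := ⟨m - (s + 1), by omega⟩
  rw [show e + 1 + s - (s + 1) = e by omega]
  have hs : s < (e + 1).choose 2 := by
    rw [choose_two_succ]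
    omega
  rw [mathcalC_add_eq hs]
  refine ⟨fun Γ _ he hm => ?_, earlyMonoid (e + 1 + s) s,
    isNumericalMonoid_levelMonoid (by omega), ?_, mult_levelMonoid (by omega), ?_⟩
  · have := (rho_add_le he hm).2
    omega
  · have := edim_earlyMonoid (m := e + 1 + s) (s := s) (by omega)
    omega
  · have hedim := edim_earlyMonoid (m := e + 1 + s) (s := s) (by omega)
    have h1 := (rho_add_le (Γ := earlyMonoid (e + 1 + s) s) (e := e) (s := s) (by omega)
      (mult_levelMonoid (by omega))).2
    have h2 := le_rho_earlyMonoid (m := e + 1 + s) (s := s) (by omega) rfl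
    omega
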